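/- arXiv:1701.04841 — 4 statements merged into one kernel-verified Lean document; each statement's English description precedes it below -/
import Mathlib

section
/- Let ρ∞ ∈ P_o(G) be a Gibbs measure. Assume there is λ > 0 with Hess𝓕(σ) ⪰ λ·I for all σ ∈ P_o(G), let ρ ∈ P_o(G) satisfy ρ_i ≥ m for all i with some m ∈ (0, 1/n], let h₁ > 0 satisfy ‖Hess𝓕(σ)‖₁ ≤ h₁ (maximum absolute column sum norm) for every σ on the line segment from ρ to ρ∞, and suppose 𝓕(ρ) − 𝓕(ρ∞) ≤ x for some x ≥ 0. Set C₂ = 2·m·λ·λ_sec(L̂) and C₃ = 2√2·Deg(G)·max_{(i,j)∈E} ω_{ij}·(h₁/√λ)·((1−m)/m)·(λ_max(L̂)/λ_sec(L̂)). Then, writing ρ̇ = −L(ρ)F(ρ), one has 2·ρ̇^T Hess𝓕(ρ) ρ̇ − F(ρ)^T L(ρ̇) F(ρ) ≥ (C₂ − C₃·√x)·F(ρ)^T L(ρ) F(ρ). -/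
open Finset Filter Matrix
open scoped Classical

noncomputable section

namespace FPEGraph

variable {n : ℕ}

/-- Edge average `θ_{ij}(ρ) = (ρ_i + ρ_j)/2`. -/
def theta (ρ : Fin n → ℝ) (i j : Fin n) : ℝ := (ρ i + ρ j) / 2

/-- Weighted graph Laplacian `L(ρ)`, satisfying
`(L(ρ)Φ)_i = ∑_{j} ω_{ij} θ_{ij}(ρ) (Φ_i - Φ_j)` (the sum over all `j` equals the
sum over neighbors since `ω_{ij} = 0` off edges). -/
def Lmat (ω : Fin n → Fin n → ℝ) (ρ : Fin n → ℝ) : Matrix (Fin n) (Fin n) ℝ :=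
  fun i j => if i = j then ∑ k, ω i k * theta ρ i k else -(ω i j * theta ρ i j)

/-- Graph Laplacian `L̂`, with `(L̂Φ)_i = ∑_{j} ω_{ij} (Φ_i - Φ_j)`. -/
def Lhat (ω : Fin n → Fin n → ℝ) : Matrix (Fin n) (Fin n) ℝ :=
  fun i j => if i = j then ∑ k, ω i k else -(ω i j)

/-- Connectivity of the weighted graph: any two vertices are joined by a chain of edges. -/
def Conn (ω : Fin n → Fin n → ℝ) : Prop :=
  ∀ i j : Fin n, Relation.ReflTransGen (fun a b => ω a b ≠ 0) i j

/-- `ω` encodes a connected undirected weighted graph without self-loops: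
symmetric nonnegative weights, zero diagonal, connected (edges are pairs with `ω_{ij} > 0`,
i.e. `ω_{ij} ≠ 0`). -/
def IsGraph (ω : Fin n → Fin n → ℝ) : Prop :=
  (∀ i j, ω i j = ω j i) ∧ (∀ i, ω i i = 0) ∧ (∀ i j, 0 ≤ ω i j) ∧ Conn ω

/-- The probability simplex `P(G)`. -/
def PG (ρ : Fin n → ℝ) : Prop := (∑ i, ρ i) = 1 ∧ ∀ i, 0 ≤ ρ i

/-- The interior `P_o(G)` of the probability simplex. -/
def PoG (ρ : Fin n → ℝ) : Prop := (∑ i, ρ i) = 1 ∧ ∀ i, 0 < ρ i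

/-- Free energy `𝓕(ρ) = (1/2) ρᵀ𝕎ρ + 𝕍ᵀρ + β ∑ᵢ ρᵢ log ρᵢ`. -/
def freeEnergy (W : Matrix (Fin n) (Fin n) ℝ) (V : Fin n → ℝ) (β : ℝ) (ρ : Fin n → ℝ) : ℝ :=
  (1/2) * (ρ ⬝ᵥ W.mulVec ρ) + V ⬝ᵥ ρ + β * ∑ i, ρ i * Real.log (ρ i)

/-- Gradient `F(ρ)` of the free energy, `F_i(ρ) = 𝕍_i + (𝕎ρ)_i + β log ρ_i + β`. -/
def gradF (W : Matrix (Fin n) (Fin n) ℝ) (V : Fin n → ℝ) (β : ℝ) (ρ : Fin n → ℝ) :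
    Fin n → ℝ :=
  fun i => V i + W.mulVec ρ i + β * Real.log (ρ i) + β

/-- Hessian `Hess𝓕(ρ) = 𝕎 + β diag(1/ρ₁, …, 1/ρₙ)`. -/
def hessF (W : Matrix (Fin n) (Fin n) ℝ) (β : ℝ) (ρ : Fin n → ℝ) :
    Matrix (Fin n) (Fin n) ℝ :=
  W + β • Matrix.diagonal (fun i => (ρ i)⁻¹)

/-- Gibbs measure: `ρ∞ ∈ P_o(G)` with `ρ∞_i = e^{-((𝕎ρ∞)_i + 𝕍_i)/β} / K`. -/
def IsGibbs (W : Matrix (Fin n) (Fin n) ℝ) (V : Fin n → ℝ) (β : ℝ) (ρ : Fin n → ℝ) : Prop :=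
  PoG ρ ∧ ∀ i, ρ i = Real.exp (-(W.mulVec ρ i + V i) / β) /
      ∑ j, Real.exp (-(W.mulVec ρ j + V j) / β)

/-- A continuously differentiable solution `ρ : [0,∞) → P_o(G)` of the Fokker–Planck
equation `ρ' = -L(ρ)F(ρ)`. -/
def IsSolution (ω : Fin n → Fin n → ℝ) (W : Matrix (Fin n) (Fin n) ℝ) (V : Fin n → ℝ)
    (β : ℝ) (ρ : ℝ → Fin n → ℝ) : Prop :=
  (∀ t ∈ Set.Ici (0:ℝ), PoG (ρ t)) ∧
  ∀ t ∈ Set.Ici (0:ℝ),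
    HasDerivWithinAt ρ (-(Lmat ω (ρ t)).mulVec (gradF W V β (ρ t))) (Set.Ici 0) t

/-- `M = e^{2 max_{i,j}(|𝕍_i| + |𝕎_{ij}|)}`. -/
def Mconst (W : Matrix (Fin n) (Fin n) ℝ) (V : Fin n → ℝ) : ℝ :=
  Real.exp (2 * ⨆ i : Fin n, ⨆ j : Fin n, (|V i| + |W i j|))

/-- `m(ρ⁰) = (1/2) (1/(1+(2M)^{1/β}))^{n-2} min{1/(1+(2M)^{1/β}), minᵢ ρ⁰ᵢ}`. -/
def mconst (W : Matrix (Fin n) (Fin n) ℝ) (V : Fin n → ℝ) (β : ℝ) (ρ0 : Fin n → ℝ) : ℝ :=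
  (1/2) * (1 / (1 + (2 * Mconst W V) ^ (1/β)))^(n-2) *
    min (1 / (1 + (2 * Mconst W V) ^ (1/β))) (⨅ i, ρ0 i)

/-- Second smallest eigenvalue (via the Rayleigh quotient on the orthogonal complement of
the constants; for the symmetric PSD Laplacians considered here, whose kernel is spanned by
the constant vector, this is exactly the second-smallest eigenvalue with multiplicity). -/
def lamSec (A : Matrix (Fin n) (Fin n) ℝ) : ℝ :=
  sInf {x | ∃ Φ : Fin n → ℝ, (∑ i, Φ i) = 0 ∧ (∑ i, (Φ i)^2) = 1 ∧ x = Φ ⬝ᵥ A.mulVec Φ}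

/-- Largest eigenvalue of a symmetric matrix, via the Rayleigh quotient. -/
def lamMax (A : Matrix (Fin n) (Fin n) ℝ) : ℝ :=
  sSup {x | ∃ Φ : Fin n → ℝ, (∑ i, (Φ i)^2) = 1 ∧ x = Φ ⬝ᵥ A.mulVec Φ}

/-- Maximum absolute column sum norm `‖A‖₁`. -/
def matNorm1 (A : Matrix (Fin n) (Fin n) ℝ) : ℝ := ⨆ j : Fin n, ∑ i, |A i j|

/-- Maximal vertex degree `Deg(G)`. -/
def maxDeg (ω : Fin n → Fin n → ℝ) : ℕ :=
  Finset.univ.sup fun i => (Finset.univ.filter fun j => ω i j ≠ 0).card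

/-- Maximal edge weight `max_{(i,j)∈E} ω_{ij}` (equal to the max over all pairs since
`ω = 0` off edges and weights are positive on edges). -/
def maxWeight (ω : Fin n → Fin n → ℝ) : ℝ := ⨆ i : Fin n, ⨆ j : Fin n, ω i j

/-- A vector field on `G`: a skew-symmetric matrix vanishing off edges. -/
def IsVF (ω : Fin n → Fin n → ℝ) (v : Fin n → Fin n → ℝ) : Prop :=
  (∀ i j, v i j = - v j i) ∧ ∀ i j, ω i j = 0 → v i j = 0

/-- Potential vector field `(∇_G Φ)_{ij} = √ω_{ij} (Φ_i - Φ_j)` (this vanishes off edges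
since `ω_{ij} = 0` there). -/
def gradG (ω : Fin n → Fin n → ℝ) (Φ : Fin n → ℝ) : Fin n → Fin n → ℝ :=
  fun i j => Real.sqrt (ω i j) * (Φ i - Φ j)

/-- Divergence `div_G(ρv)_i = -∑_j √ω_{ij} v_{ij} θ_{ij}(ρ)` (sum over all `j` equals the
sum over neighbors since `√ω_{ij} = 0` off edges). -/
def divG (ω : Fin n → Fin n → ℝ) (ρ : Fin n → ℝ) (v : Fin n → Fin n → ℝ) : Fin n → ℝ :=
  fun i => -∑ j, Real.sqrt (ω i j) * v i j * theta ρ i j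

/-- Inner product `(v,w)_ρ = (1/2) ∑_{(i,j)∈E} v_{ij} w_{ij} θ_{ij}(ρ)`. -/
def innerG (ω : Fin n → Fin n → ℝ) (ρ : Fin n → ℝ) (v w : Fin n → Fin n → ℝ) : ℝ :=
  (1/2) * ∑ i, ∑ j, if ω i j ≠ 0 then v i j * w i j * theta ρ i j else 0

/-! ### Dirichlet forms of weighted Laplacians -/

theorem Lhat_mulVec {w : Fin n → Fin n → ℝ} (hd : ∀ i, w i i = 0) (Φ : Fin n → ℝ) (i : Fin n) :
    (Lhat w).mulVec Φ i = ∑ j, w i j * (Φ i - Φ j) := by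
  have h : ∀ j, Lhat w i j * Φ j =
      (if i = j then (∑ k, w i k) * Φ i else 0) - w i j * Φ j := by
    intro j
    unfold Lhat
    split_ifs with hij
    · subst hij
      simp [hd]
    · ring
  simp only [mulVec, dotProduct, h, mul_sub, Finset.sum_sub_distrib, Finset.sum_ite_eq,
    Finset.mem_univ, if_true, Finset.sum_mul]

theorem dotProduct_Lhat_mulVec {w : Fin n → Fin n → ℝ} (hs : ∀ i j, w i j = w j i)
    (hd : ∀ i, w i i = 0) (Ψ Φ : Fin n → ℝ) :
    Ψ ⬝ᵥ (Lhat w).mulVec Φ = 1 / 2 * ∑ i, ∑ j, w i j * ((Ψ i - Ψ j) * (Φ i - Φ j)) := by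
  have h1 : Ψ ⬝ᵥ (Lhat w).mulVec Φ = ∑ i, ∑ j, w i j * (Ψ i * (Φ i - Φ j)) := by
    simp only [dotProduct, Lhat_mulVec hd, Finset.mul_sum]
    exact Finset.sum_congr rfl fun i _ => Finset.sum_congr rfl fun j _ => by ring
  have h2 : Ψ ⬝ᵥ (Lhat w).mulVec Φ = ∑ i, ∑ j, w i j * (Ψ j * (Φ j - Φ i)) := by
    rw [h1, Finset.sum_comm]
    exact Finset.sum_congr rfl fun i _ => Finset.sum_congr rfl fun j _ => by rw [hs]
  have h3 : ∑ i, ∑ j, w i j * ((Ψ i - Ψ j) * (Φ i - Φ j)) =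
      ∑ i, ∑ j, w i j * (Ψ i * (Φ i - Φ j)) + ∑ i, ∑ j, w i j * (Ψ j * (Φ j - Φ i)) := by
    simp only [← Finset.sum_add_distrib]
    exact Finset.sum_congr rfl fun i _ => Finset.sum_congr rfl fun j _ => by ring
  rw [h3, ← h1, ← h2]
  ring

theorem Lmat_eq_Lhat (ω : Fin n → Fin n → ℝ) (ρ : Fin n → ℝ) :
    Lmat ω ρ = Lhat fun i j => ω i j * theta ρ i j := rfl

theorem theta_comm (ρ : Fin n → ℝ) (i j : Fin n) : theta ρ i j = theta ρ j i := by
  unfold theta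
  ring

theorem dotProduct_Lhat_mulVec_mono {w w' : Fin n → Fin n → ℝ} (hs : ∀ i j, w i j = w j i)
    (hd : ∀ i, w i i = 0) (hs' : ∀ i j, w' i j = w' j i) (hd' : ∀ i, w' i i = 0)
    (hle : ∀ i j, w i j ≤ w' i j) (Φ : Fin n → ℝ) :
    Φ ⬝ᵥ (Lhat w).mulVec Φ ≤ Φ ⬝ᵥ (Lhat w').mulVec Φ := by
  rw [dotProduct_Lhat_mulVec hs hd, dotProduct_Lhat_mulVec hs' hd']
  gcongr with i _ j _
  · exact mul_self_nonneg _
  · exact hle i j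

theorem dotProduct_Lhat_mulVec_const_mul {w : Fin n → Fin n → ℝ} (hs : ∀ i j, w i j = w j i)
    (hd : ∀ i, w i i = 0) (c : ℝ) (Φ : Fin n → ℝ) :
    Φ ⬝ᵥ (Lhat fun i j => c * w i j).mulVec Φ = c * (Φ ⬝ᵥ (Lhat w).mulVec Φ) := by
  rw [dotProduct_Lhat_mulVec hs hd, dotProduct_Lhat_mulVec (fun i j => by rw [hs])
    (fun i => by rw [hd, mul_zero])]
  simp only [Finset.mul_sum]
  exact Finset.sum_congr rfl fun i _ => Finset.sum_congr rfl fun j _ => by ring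

/-! ### Extremal Rayleigh quotients -/

theorem isCompact_unitSphere : IsCompact {Φ : Fin n → ℝ | ∑ i, (Φ i) ^ 2 = 1} := by
  refine Metric.isCompact_of_isClosed_isBounded ?_ ?_
  · exact isClosed_eq (by fun_prop) continuous_const
  · refine (Metric.isBounded_closedBall (x := (0 : Fin n → ℝ)) (r := 1)).subset fun Φ hΦ => ?_
    rw [mem_closedBall_zero_iff, pi_norm_le_iff_of_nonneg zero_le_one]
    intro i
    rw [Real.norm_eq_abs, ← sq_le_one_iff_abs_le_one, ← (hΦ : ∑ i, (Φ i) ^ 2 = 1)]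
    exact Finset.single_le_sum (f := fun i => (Φ i) ^ 2) (fun _ _ => sq_nonneg _)
      (Finset.mem_univ i)

theorem continuous_quadForm (A : Matrix (Fin n) (Fin n) ℝ) :
    Continuous fun Φ : Fin n → ℝ => Φ ⬝ᵥ A.mulVec Φ := by
  simp only [dotProduct, mulVec]
  fun_prop

theorem exists_eq_lamSec (hn : 2 ≤ n) (A : Matrix (Fin n) (Fin n) ℝ) :
    ∃ Φ : Fin n → ℝ, (∑ i, Φ i) = 0 ∧ (∑ i, (Φ i) ^ 2) = 1 ∧ lamSec A = Φ ⬝ᵥ A.mulVec Φ ∧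
      ∀ Ψ : Fin n → ℝ, (∑ i, Ψ i) = 0 → (∑ i, (Ψ i) ^ 2) = 1 → lamSec A ≤ Ψ ⬝ᵥ A.mulVec Ψ := by
  have hc : IsCompact {Φ : Fin n → ℝ | (∑ i, (Φ i) ^ 2 = 1) ∧ (∑ i, Φ i) = 0} :=
    isCompact_unitSphere.inter_right (isClosed_eq (by fun_prop) continuous_const)
  have hne : {Φ : Fin n → ℝ | (∑ i, (Φ i) ^ 2 = 1) ∧ (∑ i, Φ i) = 0}.Nonempty := by
    obtain ⟨k, rfl⟩ := Nat.exists_eq_add_of_le' hn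
    refine ⟨Fin.cons (Real.sqrt 2)⁻¹ (Fin.cons (-(Real.sqrt 2)⁻¹) fun _ => 0), ?_, ?_⟩
    · rw [Fin.sum_univ_succ, Fin.sum_univ_succ]
      simp
      norm_num
    · rw [Fin.sum_univ_succ, Fin.sum_univ_succ]
      simp
  obtain ⟨Φ, ⟨h1, h2⟩, hmin⟩ := hc.exists_isMinOn hne (continuous_quadForm A).continuousOn
  have hleast : IsLeast {x | ∃ Φ : Fin n → ℝ, (∑ i, Φ i) = 0 ∧ (∑ i, (Φ i)^2) = 1 ∧
      x = Φ ⬝ᵥ A.mulVec Φ} (Φ ⬝ᵥ A.mulVec Φ) := by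
    refine ⟨⟨Φ, h2, h1, rfl⟩, ?_⟩
    rintro _ ⟨Ψ, h3, h4, rfl⟩
    exact hmin ⟨h4, h3⟩
  have heq : lamSec A = Φ ⬝ᵥ A.mulVec Φ := hleast.csInf_eq
  exact ⟨Φ, h2, h1, heq, fun Ψ h3 h4 => heq ▸ hmin ⟨h4, h3⟩⟩

theorem lamSec_le_lamMax (hn : 2 ≤ n) (A : Matrix (Fin n) (Fin n) ℝ) : lamSec A ≤ lamMax A := by
  obtain ⟨Φ, -, h2, heq, -⟩ := exists_eq_lamSec hn A
  rw [heq]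
  refine le_csSup ?_ ⟨Φ, h2, rfl⟩
  refine (isCompact_unitSphere.bddAbove_image (continuous_quadForm A).continuousOn).mono ?_
  rintro _ ⟨Ψ, h3, rfl⟩
  exact ⟨Ψ, h3, rfl⟩

theorem lamSec_mul_le (hn : 2 ≤ n) (A : Matrix (Fin n) (Fin n) ℝ) {Φ : Fin n → ℝ}
    (h0 : ∑ i, Φ i = 0) : lamSec A * ∑ i, (Φ i) ^ 2 ≤ Φ ⬝ᵥ A.mulVec Φ := by
  obtain ⟨-, -, -, -, hle⟩ := exists_eq_lamSec hn A
  rcases (Finset.sum_nonneg fun i _ => sq_nonneg (Φ i)).eq_or_lt with hz | hpos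
  · have : Φ = 0 := by
      funext i
      have := (Finset.sum_eq_zero_iff_of_nonneg fun i _ => sq_nonneg (Φ i)).1 hz.symm i
        (Finset.mem_univ i)
      simpa using this
    simp [this]
  · set S := ∑ i, (Φ i) ^ 2 with hS
    have hsq : Real.sqrt S ^ 2 = S := Real.sq_sqrt hpos.le
    have := hle ((Real.sqrt S)⁻¹ • Φ)
      (by simp [← Finset.mul_sum, h0])
      (by simp only [Pi.smul_apply, smul_eq_mul, mul_pow, ← Finset.mul_sum, inv_pow, hsq, ← hS]
          exact inv_mul_cancel₀ hpos.ne')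
    rw [mulVec_smul, dotProduct_smul, smul_dotProduct, smul_eq_mul, smul_eq_mul, ← mul_assoc,
      ← sq, inv_pow, hsq] at this
    calc lamSec A * S ≤ S⁻¹ * (Φ ⬝ᵥ A.mulVec Φ) * S := by gcongr
      _ = Φ ⬝ᵥ A.mulVec Φ := by field_simp

theorem lamSec_Lhat_pos (hn : 2 ≤ n) {ω : Fin n → Fin n → ℝ} (hG : IsGraph ω) :
    0 < lamSec (Lhat ω) := by
  obtain ⟨hs, hd, hω, hconn⟩ := hG
  obtain ⟨Φ, h0, h1, heq, -⟩ := exists_eq_lamSec hn (Lhat ω)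
  rw [heq, dotProduct_Lhat_mulVec hs hd]
  have hterm : ∀ i j, 0 ≤ ω i j * ((Φ i - Φ j) * (Φ i - Φ j)) := fun i j =>
    mul_nonneg (hω i j) (mul_self_nonneg _)
  have hnn : 0 ≤ ∑ i, ∑ j, ω i j * ((Φ i - Φ j) * (Φ i - Φ j)) :=
    Finset.sum_nonneg fun i _ => Finset.sum_nonneg fun j _ => hterm i j
  refine mul_pos (by norm_num) (hnn.lt_of_ne fun hz => ?_)
  have hedge : ∀ i j, ω i j ≠ 0 → Φ i = Φ j := by
    intro i j hij
    have hi := (Finset.sum_eq_zero_iff_of_nonneg fun i _ =>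
      Finset.sum_nonneg fun j _ => hterm i j).1 hz.symm i (Finset.mem_univ i)
    have hj := (Finset.sum_eq_zero_iff_of_nonneg fun j _ => hterm i j).1 hi j (Finset.mem_univ j)
    rcases mul_eq_zero.1 hj with h | h
    · exact absurd h hij
    · exact sub_eq_zero.1 (mul_self_eq_zero.1 h)
  have hconst : ∀ i j, Φ i = Φ j := fun i j =>
    (hconn i j).rec rfl fun _ hbc ih => ih.trans (hedge _ _ hbc)
  have hzero : ∀ i, Φ i = 0 := by
    intro i
    have hsum : ∑ j, Φ j = n * Φ i := by
      rw [Finset.sum_congr rfl fun j _ => hconst j i]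
      simp
    rw [h0] at hsum
    exact (mul_eq_zero.1 hsum.symm).resolve_left (by positivity)
  simp [hzero] at h1

/-- A spectral gap of the Dirichlet form on mean-zero functions bounds `‖L Φ‖²` from below. -/
theorem mul_dotProduct_Lhat_le_sum_sq (hn : 2 ≤ n) {w : Fin n → Fin n → ℝ}
    (hs : ∀ i j, w i j = w j i) (hd : ∀ i, w i i = 0) {μ : ℝ} (hμ : 0 < μ)
    (hgap : ∀ Ψ : Fin n → ℝ, ∑ i, Ψ i = 0 → μ * ∑ i, (Ψ i) ^ 2 ≤ Ψ ⬝ᵥ (Lhat w).mulVec Ψ)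
    (Φ : Fin n → ℝ) :
    μ * (Φ ⬝ᵥ (Lhat w).mulVec Φ) ≤ ∑ i, ((Lhat w).mulVec Φ i) ^ 2 := by
  set a : ℝ := (∑ i, Φ i) / n
  set Ψ : Fin n → ℝ := fun i => Φ i - a
  have hΨ0 : ∑ i, Ψ i = 0 := by
    have : (n : ℝ) ≠ 0 := by positivity
    simp only [Ψ, a, Finset.sum_sub_distrib, Finset.sum_const, Finset.card_univ, Fintype.card_fin,
      nsmul_eq_mul]
    field_simp
    ring
  have hL : (Lhat w).mulVec Ψ = (Lhat w).mulVec Φ := by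
    funext i
    simp [Lhat_mulVec hd, Ψ]
  have hform : Φ ⬝ᵥ (Lhat w).mulVec Φ = Ψ ⬝ᵥ (Lhat w).mulVec Ψ := by
    simp [dotProduct_Lhat_mulVec hs hd, Ψ]
  have hcs : (Ψ ⬝ᵥ (Lhat w).mulVec Ψ) ^ 2 ≤
      (∑ i, (Ψ i) ^ 2) * ∑ i, ((Lhat w).mulVec Ψ i) ^ 2 :=
    Finset.sum_mul_sq_le_sq_mul_sq _ _ _
  have hg := hgap Ψ hΨ0
  rw [hform, ← hL]
  set D := Ψ ⬝ᵥ (Lhat w).mulVec Ψ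
  set S := ∑ i, (Ψ i) ^ 2
  set R := ∑ i, ((Lhat w).mulVec Ψ i) ^ 2
  have hS : 0 ≤ S := Finset.sum_nonneg fun i _ => sq_nonneg _
  have hR : 0 ≤ R := Finset.sum_nonneg fun i _ => sq_nonneg _
  have hD : 0 ≤ D := (mul_nonneg hμ.le hS).trans hg
  rcases hD.eq_or_lt with h | h
  · rw [← h, mul_zero]
    exact hR
  · refine le_of_mul_le_mul_right ?_ h
    calc μ * D * D = μ * D ^ 2 := by ring
      _ ≤ μ * (S * R) := by gcongr
      _ = (μ * S) * R := by ring
      _ ≤ D * R := by gcongr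
      _ = R * D := mul_comm _ _

/-! ### Graph constants -/

theorem le_maxWeight (ω : Fin n → Fin n → ℝ) (i j : Fin n) : ω i j ≤ maxWeight ω :=
  (le_ciSup (Set.finite_range fun j => ω i j).bddAbove j).trans
    (le_ciSup (Set.finite_range fun i => ⨆ j, ω i j).bddAbove i)

theorem sum_weight_le {ω : Fin n → Fin n → ℝ} (hω : ∀ i j, 0 ≤ ω i j) (i : Fin n) :
    ∑ j, ω i j ≤ maxDeg ω * maxWeight ω := by
  calc ∑ j, ω i j = ∑ j ∈ Finset.univ.filter fun j => ω i j ≠ 0, ω i j :=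
        (Finset.sum_filter_ne_zero _).symm
    _ ≤ (Finset.univ.filter fun j => ω i j ≠ 0).card • maxWeight ω :=
        Finset.sum_le_card_nsmul _ _ _ fun j _ => le_maxWeight ω i j
    _ ≤ maxDeg ω * maxWeight ω := by
        rw [nsmul_eq_mul]
        refine mul_le_mul_of_nonneg_right ?_ ((hω i i).trans (le_maxWeight ω i i))
        exact_mod_cast Finset.le_sup (f := fun i => (Finset.univ.filter fun j => ω i j ≠ 0).card)
          (Finset.mem_univ i)

theorem sum_abs_le_matNorm1 (A : Matrix (Fin n) (Fin n) ℝ) (j : Fin n) :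
    ∑ i, |A i j| ≤ matNorm1 A :=
  le_ciSup (Set.finite_range fun j => ∑ i, |A i j|).bddAbove j

theorem abs_mulVec_le {A : Matrix (Fin n) (Fin n) ℝ} (hA : A.IsSymm) {d : Fin n → ℝ} {r : ℝ}
    (hd : ∀ i, |d i| ≤ r) (hr : 0 ≤ r) (i : Fin n) : |A.mulVec d i| ≤ matNorm1 A * r := by
  calc |A.mulVec d i| ≤ ∑ j, |A i j * d j| :=
        Finset.abs_sum_le_sum_abs (fun j => A i j * d j) Finset.univ
    _ ≤ ∑ j, |A j i| * r := by
        refine Finset.sum_le_sum fun j _ => ?_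
        rw [abs_mul, hA.apply j i]
        exact mul_le_mul_of_nonneg_left (hd j) (abs_nonneg _)
    _ ≤ matNorm1 A * r := by
        rw [← Finset.sum_mul]
        exact mul_le_mul_of_nonneg_right (sum_abs_le_matNorm1 A i) hr

/-! ### The free energy along a segment -/

theorem isSymm_hessF {W : Matrix (Fin n) (Fin n) ℝ} (hW : W.IsSymm) (β : ℝ) (ρ : Fin n → ℝ) :
    (hessF W β ρ).IsSymm :=
  hW.add ((Matrix.isSymm_diagonal _).smul β)

theorem PoG.segment {ρ σ : Fin n → ℝ} (hρ : PoG ρ) (hσ : PoG σ) {s : ℝ}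
    (hs : s ∈ Set.Icc (0 : ℝ) 1) : PoG fun i => (1 - s) * ρ i + s * σ i := by
  refine ⟨?_, fun i => ?_⟩
  · rw [Finset.sum_add_distrib, ← Finset.mul_sum, ← Finset.mul_sum, hρ.1, hσ.1]
    ring
  · rcases hs.1.eq_or_lt with h | h
    · simpa [← h] using hρ.2 i
    · exact add_pos_of_nonneg_of_pos (mul_nonneg (by linarith [hs.2]) (hρ.2 i).le)
        (mul_pos h (hσ.2 i))

theorem IsGibbs.exists_gradF_eq {W : Matrix (Fin n) (Fin n) ℝ} {V : Fin n → ℝ} {β : ℝ}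
    (hβ : 0 < β) {ρ : Fin n → ℝ} (h : IsGibbs W V β ρ) : ∃ c, ∀ i, gradF W V β ρ i = c := by
  refine ⟨β - β * Real.log (∑ j, Real.exp (-(W.mulVec ρ j + V j) / β)), fun i => ?_⟩
  have hK : 0 < ∑ j, Real.exp (-(W.mulVec ρ j + V j) / β) :=
    Finset.sum_pos (fun j _ => Real.exp_pos _) ⟨i, Finset.mem_univ i⟩
  have hlog : Real.log (ρ i) = -(W.mulVec ρ i + V i) / β -
      Real.log (∑ j, Real.exp (-(W.mulVec ρ j + V j) / β)) := by
    conv_lhs => rw [h.2 i, Real.log_div (Real.exp_pos _).ne' hK.ne', Real.log_exp]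
  rw [gradF, hlog]
  field_simp
  ring

theorem hasDerivAt_segment (ρ σ : Fin n → ℝ) (s : ℝ) (i : Fin n) :
    HasDerivAt (fun s : ℝ => (1 - s) * ρ i + s * σ i) (σ i - ρ i) s := by
  have := (((hasDerivAt_id s).const_sub 1).mul_const (ρ i)).add
    ((hasDerivAt_id s).mul_const (σ i))
  exact this.congr_deriv (by ring)

theorem hasDerivAt_mulVec_segment (W : Matrix (Fin n) (Fin n) ℝ) (ρ σ : Fin n → ℝ) (s : ℝ)
    (i : Fin n) :
    HasDerivAt (fun s : ℝ => W.mulVec (fun i => (1 - s) * ρ i + s * σ i) i)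
      (W.mulVec (fun i => σ i - ρ i) i) s := by
  simp only [mulVec, dotProduct]
  exact HasDerivAt.fun_sum fun j _ => (hasDerivAt_segment ρ σ s j).const_mul (W i j)

theorem hasDerivAt_gradF_segment (W : Matrix (Fin n) (Fin n) ℝ) (V : Fin n → ℝ) (β : ℝ)
    (ρ σ : Fin n → ℝ) (s : ℝ) (i : Fin n) (hpos : (1 - s) * ρ i + s * σ i ≠ 0) :
    HasDerivAt (fun s : ℝ => gradF W V β (fun i => (1 - s) * ρ i + s * σ i) i)
      ((hessF W β fun i => (1 - s) * ρ i + s * σ i).mulVec (fun i => σ i - ρ i) i) s := by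
  have := (((hasDerivAt_mulVec_segment W ρ σ s i).const_add (V i)).add
    (((hasDerivAt_segment ρ σ s i).log hpos).const_mul β)).add_const β
  refine this.congr_deriv ?_
  simp only [hessF, add_mulVec, smul_mulVec, Pi.add_apply, Pi.smul_apply, mulVec_diagonal,
    smul_eq_mul]
  ring

theorem hasDerivAt_freeEnergy_segment {W : Matrix (Fin n) (Fin n) ℝ} (hW : W.IsSymm)
    (V : Fin n → ℝ) (β : ℝ) (ρ σ : Fin n → ℝ) (s : ℝ)
    (hpos : ∀ i, (1 - s) * ρ i + s * σ i ≠ 0) :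
    HasDerivAt (fun s : ℝ => freeEnergy W V β fun i => (1 - s) * ρ i + s * σ i)
      ((fun i => σ i - ρ i) ⬝ᵥ gradF W V β fun i => (1 - s) * ρ i + s * σ i) s := by
  have h1 : HasDerivAt (fun s : ℝ => ∑ i, ((1 - s) * ρ i + s * σ i) *
      W.mulVec (fun i => (1 - s) * ρ i + s * σ i) i) _ s :=
    HasDerivAt.fun_sum fun i _ =>
      (hasDerivAt_segment ρ σ s i).mul (hasDerivAt_mulVec_segment W ρ σ s i)
  have h2 : HasDerivAt (fun s : ℝ => ∑ i, V i * ((1 - s) * ρ i + s * σ i)) _ s :=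
    HasDerivAt.fun_sum fun i _ => (hasDerivAt_segment ρ σ s i).const_mul (V i)
  have h3 : HasDerivAt (fun s : ℝ => ∑ i, ((1 - s) * ρ i + s * σ i) *
      Real.log ((1 - s) * ρ i + s * σ i)) _ s :=
    HasDerivAt.fun_sum fun i _ =>
      (hasDerivAt_segment ρ σ s i).mul ((hasDerivAt_segment ρ σ s i).log (hpos i))
  have hsymm : ∑ i, ((1 - s) * ρ i + s * σ i) * W.mulVec (fun i => σ i - ρ i) i =
      ∑ i, (σ i - ρ i) * W.mulVec (fun i => (1 - s) * ρ i + s * σ i) i := by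
    change (fun i => (1 - s) * ρ i + s * σ i) ⬝ᵥ W.mulVec (fun i => σ i - ρ i) =
      (fun i => σ i - ρ i) ⬝ᵥ W.mulVec (fun i => (1 - s) * ρ i + s * σ i)
    rw [dotProduct_mulVec, ← mulVec_transpose, hW.eq, dotProduct_comm]
  refine (((h1.const_mul (1 / 2)).add h2).add (h3.const_mul β)).congr_deriv ?_
  rw [Finset.sum_add_distrib, hsymm, ← two_mul, ← mul_assoc, one_div_mul_cancel two_ne_zero,
    one_mul, Finset.mul_sum, ← Finset.sum_add_distrib, ← Finset.sum_add_distrib]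
  refine Finset.sum_congr rfl fun i _ => ?_
  rw [mul_div_cancel₀ _ (hpos i), gradF]
  ring

/-- Strong convexity of the free energy gives quadratic growth at a Gibbs measure. -/
theorem IsGibbs.mul_sum_sq_le {W : Matrix (Fin n) (Fin n) ℝ} (hW : W.IsSymm) {V : Fin n → ℝ}
    {β : ℝ} (hβ : 0 < β) {ρ σ : Fin n → ℝ} (hσ : IsGibbs W V β σ) (hρ : PoG ρ) {lam : ℝ}
    (hHess : ∀ σ : Fin n → ℝ, PoG σ → ∀ Φ : Fin n → ℝ,
      lam * (∑ i, (Φ i) ^ 2) ≤ Φ ⬝ᵥ (hessF W β σ).mulVec Φ) :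
    lam / 2 * ∑ i, (σ i - ρ i) ^ 2 ≤ freeEnergy W V β ρ - freeEnergy W V β σ := by
  set d : Fin n → ℝ := fun i => σ i - ρ i with hd
  set S := ∑ i, (σ i - ρ i) ^ 2
  have hseg : ∀ s ∈ Set.Icc (0 : ℝ) 1, PoG fun i => (1 - s) * ρ i + s * σ i :=
    fun s hs => hρ.segment hσ.1 hs
  have hg : ∀ s ∈ Set.Icc (0 : ℝ) 1, HasDerivAt
      (fun s : ℝ => (d ⬝ᵥ gradF W V β fun i => (1 - s) * ρ i + s * σ i) - lam * S * s)
      ((d ⬝ᵥ (hessF W β fun i => (1 - s) * ρ i + s * σ i).mulVec d) - lam * S) s := by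
    intro s hs
    refine (HasDerivAt.sub (HasDerivAt.fun_sum fun i _ =>
      (hasDerivAt_gradF_segment W V β ρ σ s i ((hseg s hs).2 i).ne').const_mul (d i))
      ((hasDerivAt_id s).const_mul (lam * S))).congr_deriv ?_
    rw [mul_one]
    rfl
  have hmono : MonotoneOn
      (fun s : ℝ => (d ⬝ᵥ gradF W V β fun i => (1 - s) * ρ i + s * σ i) - lam * S * s)
      (Set.Icc 0 1) := by
    refine monotoneOn_of_deriv_nonneg (convex_Icc 0 1)
      (fun s hs => (hg s hs).continuousAt.continuousWithinAt)
      (fun s hs => (hg s (interior_subset hs)).differentiableAt.differentiableWithinAt)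
      fun s hs => ?_
    rw [(hg s (interior_subset hs)).deriv]
    exact sub_nonneg.2 (hHess _ (hseg s (interior_subset hs)) d)
  obtain ⟨c, hc⟩ := hσ.exists_gradF_eq hβ
  have hend : d ⬝ᵥ gradF W V β σ = 0 := by
    simp only [dotProduct, hc, ← Finset.sum_mul, hd, Finset.sum_sub_distrib, hσ.1.1, hρ.1,
      sub_self, zero_mul]
  have hφ : ∀ s ∈ Set.Icc (0 : ℝ) 1, HasDerivAt
      (fun s : ℝ => (freeEnergy W V β fun i => (1 - s) * ρ i + s * σ i) -
        lam * S / 2 * (s - 1) ^ 2)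
      ((d ⬝ᵥ gradF W V β fun i => (1 - s) * ρ i + s * σ i) - lam * S * (s - 1)) s := by
    intro s hs
    refine ((hasDerivAt_freeEnergy_segment hW V β ρ σ s fun i => ((hseg s hs).2 i).ne').sub
      ((((hasDerivAt_id s).sub_const 1).pow 2).const_mul (lam * S / 2))).congr_deriv ?_
    simp only [id]
    push_cast
    ring
  have hanti : AntitoneOn
      (fun s : ℝ => (freeEnergy W V β fun i => (1 - s) * ρ i + s * σ i) -
        lam * S / 2 * (s - 1) ^ 2) (Set.Icc 0 1) := by
    refine antitoneOn_of_deriv_nonpos (convex_Icc 0 1)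
      (fun s hs => (hφ s hs).continuousAt.continuousWithinAt)
      (fun s hs => (hφ s (interior_subset hs)).differentiableAt.differentiableWithinAt)
      fun s hs => ?_
    have hs' := interior_subset hs
    rw [(hφ s hs').deriv]
    have := hmono hs' (Set.right_mem_Icc.2 zero_le_one) hs'.2
    simp only [sub_self, zero_mul, one_mul, zero_add, hend] at this
    linarith
  have := hanti (Set.left_mem_Icc.2 zero_le_one) (Set.right_mem_Icc.2 zero_le_one) zero_le_one
  simp only [sub_self, zero_mul, one_mul, zero_add, sub_zero, add_zero] at this
  norm_num at this
  linarith

theorem IsGibbs.abs_gradF_sub_le {W : Matrix (Fin n) (Fin n) ℝ} (hW : W.IsSymm) {V : Fin n → ℝ}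
    {β : ℝ} (hβ : 0 < β) {ρ σ : Fin n → ℝ} (hσ : IsGibbs W V β σ) (hρ : PoG ρ) {h r : ℝ}
    (hseg : ∀ s ∈ Set.Icc (0 : ℝ) 1,
      matNorm1 (hessF W β (fun i => (1 - s) * ρ i + s * σ i)) ≤ h)
    (hr : 0 ≤ r) (hd : ∀ i, |σ i - ρ i| ≤ r) (i j : Fin n) :
    |gradF W V β ρ i - gradF W V β ρ j| ≤ 2 * (h * r) := by
  have key : ∀ i, |gradF W V β σ i - gradF W V β ρ i| ≤ h * r := by
    intro i
    have := norm_image_sub_le_of_norm_deriv_le_segment_01' (C := h * r)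
      (fun s hs => (hasDerivAt_gradF_segment W V β ρ σ s i
        ((hρ.segment hσ.1 hs).2 i).ne').hasDerivWithinAt)
      (fun s hs => (abs_mulVec_le (isSymm_hessF hW β _) hd hr i).trans
        (mul_le_mul_of_nonneg_right (hseg s (Set.Ico_subset_Icc_self hs)) hr))
    simpa using this
  obtain ⟨c, hc⟩ := hσ.exists_gradF_eq hβ
  have hi := abs_le.1 (key i)
  have hj := abs_le.1 (key j)
  rw [hc] at hi hj
  rw [abs_le]
  constructor <;> linarith

/-- the key estimate of Lemma 9 (convergence rate near the equilibrium):
`2 ρ̇ᵀ Hess𝓕(ρ) ρ̇ - F(ρ)ᵀ L(ρ̇) F(ρ) ≥ (C₂ - C₃ √x) F(ρ)ᵀ L(ρ) F(ρ)` with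
`C₂ = 2 m λ λ_sec(L̂)` and
`C₃ = 2√2 Deg(G) (max ω) (h₁/√λ) ((1-m)/m) (λ_max(L̂)/λ_sec(L̂))`. -/
theorem second_derivative_estimate
    (n : ℕ) (hn : 2 ≤ n) (ω : Fin n → Fin n → ℝ) (hG : IsGraph ω)
    (W : Matrix (Fin n) (Fin n) ℝ) (hW : W.IsSymm) (V : Fin n → ℝ) (β : ℝ) (hβ : 0 < β)
    (ρinf : Fin n → ℝ) (hGibbs : IsGibbs W V β ρinf)
    (lam : ℝ) (hlam : 0 < lam)
    (hHess : ∀ σ : Fin n → ℝ, PoG σ → ∀ Φ : Fin n → ℝ,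
      lam * (∑ i, (Φ i)^2) ≤ Φ ⬝ᵥ (hessF W β σ).mulVec Φ)
    (ρ : Fin n → ℝ) (hρ : PoG ρ)
    (m : ℝ) (hm : 0 < m) (hmn : m ≤ 1 / n) (hmρ : ∀ i, m ≤ ρ i)
    (h1 : ℝ) (hh1 : 0 < h1)
    (hseg : ∀ s ∈ Set.Icc (0:ℝ) 1,
      matNorm1 (hessF W β (fun i => (1 - s) * ρ i + s * ρinf i)) ≤ h1)
    (x : ℝ) (hx0 : 0 ≤ x) (hx : freeEnergy W V β ρ - freeEnergy W V β ρinf ≤ x)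
    (C2 C3 : ℝ) (hC2 : C2 = 2 * m * lam * lamSec (Lhat ω))
    (hC3 : C3 = 2 * Real.sqrt 2 * (maxDeg ω : ℝ) * maxWeight ω * (h1 / Real.sqrt lam) *
      ((1 - m) / m) * (lamMax (Lhat ω) / lamSec (Lhat ω))) :
    (C2 - C3 * Real.sqrt x) *
        (gradF W V β ρ ⬝ᵥ (Lmat ω ρ).mulVec (gradF W V β ρ)) ≤
      2 * ((-(Lmat ω ρ).mulVec (gradF W V β ρ)) ⬝ᵥ
            (hessF W β ρ).mulVec (-(Lmat ω ρ).mulVec (gradF W V β ρ))) -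
        gradF W V β ρ ⬝ᵥ
          (Lmat ω (-(Lmat ω ρ).mulVec (gradF W V β ρ))).mulVec (gradF W V β ρ) := by
  obtain ⟨hs, hd, hω, -⟩ := id hG
  have hn' : 0 < n := by omega
  have hsec := lamSec_Lhat_pos hn hG
  set F := gradF W V β ρ
  have hsθ : ∀ σ : Fin n → ℝ, ∀ i j, ω i j * theta σ i j = ω j i * theta σ j i := fun σ i j => by
    rw [hs, theta_comm]
  have hdθ : ∀ σ : Fin n → ℝ, ∀ i, ω i i * theta σ i i = 0 := fun σ i => by rw [hd, zero_mul]
  have hθm : ∀ i j, m ≤ theta ρ i j := fun i j => by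
    unfold theta
    linarith [hmρ i, hmρ j]
  have hρ1 : ∀ i, ρ i ≤ 1 - m := by
    intro i
    have : Nontrivial (Fin n) := Fin.nontrivial_iff_two_le.2 hn
    obtain ⟨j, hj⟩ := exists_ne i
    have := Finset.add_le_sum (f := ρ) (fun k _ => (hρ.2 k).le) (Finset.mem_univ i)
      (Finset.mem_univ j) hj.symm
    linarith [hρ.1, hmρ j]
  have hm1 : 0 ≤ 1 - m := (hρ.2 ⟨0, hn'⟩).le.trans (hρ1 _)
  have hθ1 : ∀ i j, theta ρ i j ≤ 1 - m := fun i j => by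
    unfold theta
    linarith [hρ1 i, hρ1 j]
  have hLhat : ∀ Φ : Fin n → ℝ,
      m * (Φ ⬝ᵥ (Lhat ω).mulVec Φ) ≤ Φ ⬝ᵥ (Lmat ω ρ).mulVec Φ := by
    intro Φ
    rw [← dotProduct_Lhat_mulVec_const_mul hs hd, Lmat_eq_Lhat]
    refine dotProduct_Lhat_mulVec_mono (fun i j => by rw [hs]) (fun i => by rw [hd, mul_zero])
      (hsθ ρ) (hdθ ρ) (fun i j => ?_) Φ
    rw [mul_comm]
    exact mul_le_mul_of_nonneg_left (hθm i j) (hω i j)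
  set D := F ⬝ᵥ (Lmat ω ρ).mulVec F
  have hDhat : 0 ≤ F ⬝ᵥ (Lhat ω).mulVec F := by
    rw [dotProduct_Lhat_mulVec hs hd]
    exact mul_nonneg (by norm_num) (Finset.sum_nonneg fun i _ => Finset.sum_nonneg fun j _ =>
      mul_nonneg (hω i j) (mul_self_nonneg _))
  have hD : 0 ≤ D := (mul_nonneg hm.le hDhat).trans (hLhat F)
  set u : Fin n → ℝ := -(Lmat ω ρ).mulVec F with hu
  -- the Hessian term
  have hfirst : m * lam * lamSec (Lhat ω) * D ≤ u ⬝ᵥ (hessF W β ρ).mulVec u := by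
    have h2 := mul_dotProduct_Lhat_le_sum_sq hn (hsθ ρ) (hdθ ρ) (mul_pos hm hsec)
      (fun Ψ hΨ => by
        rw [mul_assoc]
        exact (mul_le_mul_of_nonneg_left (lamSec_mul_le hn (Lhat ω) hΨ) hm.le).trans (hLhat Ψ)) F
    rw [← Lmat_eq_Lhat] at h2
    have h3 : ∑ i, (u i) ^ 2 = ∑ i, ((Lmat ω ρ).mulVec F i) ^ 2 := by simp [hu]
    calc m * lam * lamSec (Lhat ω) * D = lam * (m * lamSec (Lhat ω) * D) := by ring
      _ ≤ lam * ∑ i, (u i) ^ 2 := by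
          rw [h3]
          exact mul_le_mul_of_nonneg_left h2 hlam.le
      _ ≤ _ := hHess ρ hρ u
  -- the distance to equilibrium
  set r := Real.sqrt 2 * Real.sqrt x / Real.sqrt lam with hrdef
  have hr : 0 ≤ r := by positivity
  have hdist : ∀ i, |ρinf i - ρ i| ≤ r := by
    intro i
    have h2 := (hGibbs.mul_sum_sq_le hW hβ hρ hHess).trans hx
    have h3 : (ρinf i - ρ i) ^ 2 ≤ ∑ i, (ρinf i - ρ i) ^ 2 :=
      Finset.single_le_sum (f := fun i => (ρinf i - ρ i) ^ 2) (fun _ _ => sq_nonneg _)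
        (Finset.mem_univ i)
    refine abs_le_of_sq_le_sq ?_ hr
    rw [hrdef, div_pow, mul_pow, Real.sq_sqrt zero_le_two, Real.sq_sqrt hx0, Real.sq_sqrt hlam.le,
      le_div_iff₀ hlam]
    have := mul_le_mul_of_nonneg_left h3 hlam.le
    linarith
  -- the sup bound on the velocity
  set B := (maxDeg ω : ℝ) * maxWeight ω * ((1 - m) * (2 * (h1 * r))) with hB
  have hmw : 0 ≤ maxWeight ω := (hω ⟨0, hn'⟩ ⟨0, hn'⟩).trans (le_maxWeight ω _ _)
  have hB0 : 0 ≤ B := by positivity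
  have hub : ∀ i, |u i| ≤ B := by
    intro i
    rw [hu, Pi.neg_apply, abs_neg, Lmat_eq_Lhat, Lhat_mulVec (hdθ ρ)]
    calc |∑ j, ω i j * theta ρ i j * (F i - F j)|
        ≤ ∑ j, |ω i j * theta ρ i j * (F i - F j)| := Finset.abs_sum_le_sum_abs _ _
      _ ≤ ∑ j, ω i j * ((1 - m) * (2 * (h1 * r))) := by
          refine Finset.sum_le_sum fun j _ => ?_
          rw [abs_mul, abs_mul, abs_of_nonneg (hω i j), abs_of_nonneg (hm.le.trans (hθm i j)),
            mul_assoc]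
          exact mul_le_mul_of_nonneg_left (mul_le_mul (hθ1 i j)
            (hGibbs.abs_gradF_sub_le hW hβ hρ hseg hr hdist i j) (abs_nonneg _) hm1) (hω i j)
      _ ≤ B := by
          rw [← Finset.sum_mul]
          exact mul_le_mul_of_nonneg_right (sum_weight_le hω i) (by positivity)
  have hsecond : F ⬝ᵥ (Lmat ω u).mulVec F ≤ B / m * D := by
    calc F ⬝ᵥ (Lmat ω u).mulVec F ≤ F ⬝ᵥ (Lhat fun i j => B * ω i j).mulVec F := by
          rw [Lmat_eq_Lhat]
          refine dotProduct_Lhat_mulVec_mono (hsθ u) (hdθ u) (fun i j => by rw [hs])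
            (fun i => by rw [hd, mul_zero]) (fun i j => ?_) F
          rw [mul_comm]
          refine mul_le_mul_of_nonneg_right ?_ (hω i j)
          unfold theta
          linarith [le_of_abs_le (hub i), le_of_abs_le (hub j)]
      _ = B / m * (m * (F ⬝ᵥ (Lhat ω).mulVec F)) := by
          rw [dotProduct_Lhat_mulVec_const_mul hs hd]
          field_simp
      _ ≤ B / m * D := mul_le_mul_of_nonneg_left (hLhat F) (by positivity)
  have hC3B : B / m ≤ C3 * Real.sqrt x := by
    have hratio : 1 ≤ lamMax (Lhat ω) / lamSec (Lhat ω) :=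
      (one_le_div hsec).2 (lamSec_le_lamMax hn _)
    calc B / m = B / m * 1 := (mul_one _).symm
      _ ≤ B / m * (lamMax (Lhat ω) / lamSec (Lhat ω)) :=
          mul_le_mul_of_nonneg_left hratio (by positivity)
      _ = C3 * Real.sqrt x := by
          rw [hC3, hB, hrdef]
          ring
  have hlast := mul_le_mul_of_nonneg_right hC3B hD
  rw [sub_mul, hC2]
  linarith

end FPEGraph
end
end

section
/- Assume Hess𝓕(σ) is positive definite for all σ ∈ P_o(G), let ρ∞ ∈ P_o(G) be the Gibbs measure, and let ρ ∈ P_o(G). If the relative Fisher information I(ρ|ρ∞) = F(ρ)^T L(ρ) F(ρ) equals 0, then ρ = ρ∞. -/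
open Finset Filter Matrix
open scoped Classical

noncomputable section

namespace FPEGraph

variable {n : ℕ}

/-- The Laplacian acts by `(L(ρ)Φ)_i = ∑_j ω_{ij} θ_{ij}(ρ) (Φ_i - Φ_j)`. -/
lemma Lmat_mulVec_apply {ω : Fin n → Fin n → ℝ} (hdiag : ∀ i, ω i i = 0) (ρ Φ : Fin n → ℝ)
    (i : Fin n) :
    (Lmat ω ρ).mulVec Φ i = ∑ j, ω i j * theta ρ i j * (Φ i - Φ j) := by
  have entry : ∀ j, Lmat ω ρ i j * Φ j =
      (if i = j then (∑ k, ω i k * theta ρ i k) * Φ j else 0) - ω i j * theta ρ i j * Φ j := by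
    intro j
    unfold Lmat
    split_ifs with h
    · subst h
      simp [hdiag]
    · ring
  simp only [Matrix.mulVec, dotProduct, entry, Finset.sum_sub_distrib, mul_sub, Finset.sum_mul]
  simp

/-- The quadratic form of the Laplacian is the Dirichlet energy. -/
lemma dotProduct_Lmat_mulVec {ω : Fin n → Fin n → ℝ} (hsymm : ∀ i j, ω i j = ω j i)
    (hdiag : ∀ i, ω i i = 0) (ρ Φ : Fin n → ℝ) :
    Φ ⬝ᵥ (Lmat ω ρ).mulVec Φ = (1 / 2) * ∑ i, ∑ j, ω i j * theta ρ i j * (Φ i - Φ j) ^ 2 := by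
  have key : Φ ⬝ᵥ (Lmat ω ρ).mulVec Φ = ∑ i, ∑ j, ω i j * theta ρ i j * (Φ i - Φ j) * Φ i := by
    simp only [dotProduct, Lmat_mulVec_apply hdiag, Finset.mul_sum]
    exact Finset.sum_congr rfl fun i _ => Finset.sum_congr rfl fun j _ => by ring
  have swap : ∑ i, ∑ j, ω i j * theta ρ i j * (Φ i - Φ j) * Φ i =
      ∑ i, ∑ j, ω i j * theta ρ i j * (Φ i - Φ j) * -Φ j := by
    rw [Finset.sum_comm]
    refine Finset.sum_congr rfl fun i _ => Finset.sum_congr rfl fun j _ => ?_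
    rw [hsymm j i]
    unfold theta
    ring
  have total : ∑ i, ∑ j, ω i j * theta ρ i j * (Φ i - Φ j) ^ 2 =
      ∑ i, ∑ j, ω i j * theta ρ i j * (Φ i - Φ j) * Φ i +
      ∑ i, ∑ j, ω i j * theta ρ i j * (Φ i - Φ j) * -Φ j := by
    simp only [← Finset.sum_add_distrib]
    exact Finset.sum_congr rfl fun i _ => Finset.sum_congr rfl fun j _ => by ring
  rw [total, ← swap, key]
  ring

/-- On a connected graph, the kernel of the quadratic form of `L(ρ)` consists of constants. -/
lemma eq_of_dotProduct_Lmat_mulVec_eq_zero {ω : Fin n → Fin n → ℝ} (hG : IsGraph ω)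
    {ρ : Fin n → ℝ} (hρ : ∀ i, 0 < ρ i) {Φ : Fin n → ℝ}
    (h : Φ ⬝ᵥ (Lmat ω ρ).mulVec Φ = 0) (i j : Fin n) : Φ i = Φ j := by
  obtain ⟨hsymm, hdiag, hnonneg, hconn⟩ := hG
  have hθ : ∀ a b, 0 < theta ρ a b := fun a b => half_pos (add_pos (hρ a) (hρ b))
  have hterm : ∀ a b, 0 ≤ ω a b * theta ρ a b * (Φ a - Φ b) ^ 2 := fun a b =>
    mul_nonneg (mul_nonneg (hnonneg a b) (hθ a b).le) (sq_nonneg _)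
  rw [dotProduct_Lmat_mulVec hsymm hdiag] at h
  have hsum : ∑ i, ∑ j, ω i j * theta ρ i j * (Φ i - Φ j) ^ 2 = 0 := by linarith
  have hzero : ∀ a b, ω a b * theta ρ a b * (Φ a - Φ b) ^ 2 = 0 := by
    intro a b
    have ha := (Finset.sum_eq_zero_iff_of_nonneg
      fun a _ => Finset.sum_nonneg fun b _ => hterm a b).1 hsum a (Finset.mem_univ a)
    exact (Finset.sum_eq_zero_iff_of_nonneg fun b _ => hterm a b).1 ha b (Finset.mem_univ b)
  have hedge : ∀ a b, ω a b ≠ 0 → Φ a = Φ b := by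
    intro a b hab
    simpa [hab, (hθ a b).ne', sub_eq_zero] using hzero a b
  induction hconn i j with
  | refl => rfl
  | tail _ hbc ih => exact ih.trans (hedge _ _ hbc)

/-- The gradient of the free energy is constant at a Gibbs measure. -/
lemma IsGibbs.gradF_eq {W : Matrix (Fin n) (Fin n) ℝ} {V : Fin n → ℝ} {β : ℝ} (hβ : β ≠ 0)
    {ρ : Fin n → ℝ} (h : IsGibbs W V β ρ) (i : Fin n) :
    gradF W V β ρ i = β - β * Real.log (∑ j, Real.exp (-(W.mulVec ρ j + V j) / β)) := by
  have hK : 0 < ∑ j, Real.exp (-(W.mulVec ρ j + V j) / β) :=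
    Finset.sum_pos (fun _ _ => Real.exp_pos _) ⟨i, Finset.mem_univ i⟩
  have hlog := congrArg Real.log (h.2 i)
  rw [Real.log_div (Real.exp_pos _).ne' hK.ne', Real.log_exp] at hlog
  rw [gradF, hlog]
  field_simp
  ring

/-- `P_o(G)` is convex. -/
lemma PoG.add_smul_sub {ρ σ : Fin n → ℝ} (hρ : PoG ρ) (hσ : PoG σ) {t : ℝ} (ht : t ∈ Set.Ioo 0 1) :
    PoG (ρ + t • (σ - ρ)) := by
  have ht' : 0 < 1 - t := sub_pos.2 ht.2
  constructor
  · simp [Finset.sum_add_distrib, ← Finset.mul_sum, hρ.1, hσ.1]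
  · intro i
    have hcomb : (ρ + t • (σ - ρ)) i = (1 - t) * ρ i + t * σ i := by
      simp only [Pi.add_apply, Pi.smul_apply, Pi.sub_apply, smul_eq_mul]
      ring
    rw [hcomb]
    exact add_pos (mul_pos ht' (hρ.2 i)) (mul_pos ht.1 (hσ.2 i))

/-- The directional derivative of the gradient of the free energy is given by the Hessian. -/
lemma hasDerivAt_dotProduct_gradF (W : Matrix (Fin n) (Fin n) ℝ) (V : Fin n → ℝ) (β : ℝ)
    (ρ d : Fin n → ℝ) {t : ℝ} (ht : ∀ i, (ρ + t • d) i ≠ 0) :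
    HasDerivAt (fun s : ℝ => d ⬝ᵥ gradF W V β (ρ + s • d))
      (d ⬝ᵥ (hessF W β (ρ + t • d)).mulVec d) t := by
  have hcoord : ∀ i, HasDerivAt (fun s : ℝ => (ρ + s • d) i) (d i) t := by
    intro i
    simpa using ((hasDerivAt_id t).mul_const (d i)).const_add (ρ i)
  have hgrad : ∀ i, HasDerivAt (fun s : ℝ => gradF W V β (ρ + s • d) i)
      ((hessF W β (ρ + t • d)).mulVec d i) t := by
    intro i
    have hlin : HasDerivAt (fun s : ℝ => W.mulVec (ρ + s • d) i) (W.mulVec d i) t := by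
      simp only [Matrix.mulVec, dotProduct]
      exact HasDerivAt.fun_sum fun j _ => (hcoord j).const_mul (W i j)
    have hsum := ((hlin.const_add (V i)).add (((hcoord i).log (ht i)).const_mul β)).add_const β
    have hval : (hessF W β (ρ + t • d)).mulVec d i =
        W.mulVec d i + β * (d i / (ρ + t • d) i) := by
      rw [hessF, Matrix.add_mulVec, Matrix.smul_mulVec, Pi.add_apply, Pi.smul_apply,
        Matrix.mulVec_diagonal, smul_eq_mul, div_eq_inv_mul]
    rw [hval]
    exact hsum
  exact HasDerivAt.fun_sum fun i _ => (hgrad i).const_mul (d i)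

/-- vanishing relative Fisher information forces `ρ = ρ∞`. -/
theorem fisher_information_eq_zero
    (n : ℕ) (hn : 2 ≤ n) (ω : Fin n → Fin n → ℝ) (hG : IsGraph ω)
    (W : Matrix (Fin n) (Fin n) ℝ) (hW : W.IsSymm) (V : Fin n → ℝ) (β : ℝ) (hβ : 0 < β)
    (hPD : ∀ σ : Fin n → ℝ, PoG σ → (hessF W β σ).PosDef)
    (ρinf : Fin n → ℝ) (hGibbs : IsGibbs W V β ρinf)
    (ρ : Fin n → ℝ) (hρ : PoG ρ)
    (hI : gradF W V β ρ ⬝ᵥ (Lmat ω ρ).mulVec (gradF W V β ρ) = 0) :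
    ρ = ρinf := by
  by_contra hne
  set d := ρ - ρinf with hd
  have hd0 : d ≠ 0 := sub_ne_zero.2 hne
  have hdsum : ∑ i, d i = 0 := by
    simp [hd, hρ.1, hGibbs.1.1]
  have hconst : ∀ {c : ℝ} {Φ : Fin n → ℝ}, (∀ i, Φ i = c) → d ⬝ᵥ Φ = 0 := by
    intro c Φ hΦ
    simp [dotProduct, hΦ, ← Finset.sum_mul, hdsum]
  have hend : ρinf + (1 : ℝ) • d = ρ := by simp [hd]
  have hPoG : ∀ t ∈ Set.Icc (0 : ℝ) 1, PoG (ρinf + t • d) := by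
    intro t ht
    rcases ht.1.eq_or_lt with rfl | h0
    · simpa using hGibbs.1
    rcases ht.2.eq_or_lt with rfl | h1
    · rwa [hend]
    · exact hGibbs.1.add_smul_sub hρ ⟨h0, h1⟩
  have hderiv : ∀ t ∈ Set.Icc (0 : ℝ) 1,
      HasDerivAt (fun s : ℝ => d ⬝ᵥ gradF W V β (ρinf + s • d))
        (d ⬝ᵥ (hessF W β (ρinf + t • d)).mulVec d) t := fun t ht =>
    hasDerivAt_dotProduct_gradF W V β ρinf d fun i => ((hPoG t ht).2 i).ne'
  have hleft : d ⬝ᵥ gradF W V β (ρinf + (0 : ℝ) • d) = 0 := by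
    rw [zero_smul, add_zero]
    exact hconst (hGibbs.gradF_eq hβ.ne')
  have hright : d ⬝ᵥ gradF W V β (ρinf + (1 : ℝ) • d) = 0 := by
    rw [hend]
    exact hconst fun i =>
      eq_of_dotProduct_Lmat_mulVec_eq_zero hG hρ.2 hI i ⟨0, by omega⟩
  obtain ⟨t, ht, hzero⟩ := exists_hasDerivAt_eq_zero zero_lt_one
    (fun t ht => (hderiv t ht).continuousAt.continuousWithinAt) (hleft.trans hright.symm)
    fun t ht => hderiv t (Set.Ioo_subset_Icc_self ht)
  have hpos := (hPD _ (hPoG t (Set.Ioo_subset_Icc_self ht))).dotProduct_mulVec_pos hd0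
  rw [star_trivial] at hpos
  exact hpos.ne' hzero

end FPEGraph
end
end

section
/- For every vector field v on G and every ρ ∈ P_o(G) there exist Φ ∈ ℝ^n and a vector field u on G such that v = ∇_GΦ + u and div_G(ρu) = 0; this decomposition is unique (u is unique and Φ is unique up to adding a constant vector), and it satisfies (v,v)_ρ = (∇_GΦ, ∇_GΦ)_ρ + (u,u)_ρ. -/
open Finset Filter Matrix
open scoped Classical

noncomputable section

namespace FPEGraph

variable {n : ℕ}

theorem divG_add (ω : Fin n → Fin n → ℝ) (ρ : Fin n → ℝ) (v w : Fin n → Fin n → ℝ) :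
    divG ω ρ (v + w) = divG ω ρ v + divG ω ρ w := by
  ext i
  simp only [divG, Pi.add_apply, mul_add, add_mul, Finset.sum_add_distrib, neg_add]

theorem divG_smul (ω : Fin n → Fin n → ℝ) (ρ : Fin n → ℝ) (c : ℝ) (v : Fin n → Fin n → ℝ) :
    divG ω ρ (c • v) = c • divG ω ρ v := by
  ext i
  simp only [divG, Pi.smul_apply, smul_eq_mul, mul_neg, Finset.mul_sum]
  congr 1
  exact Finset.sum_congr rfl fun j _ => by ring

theorem divG_sub (ω : Fin n → Fin n → ℝ) (ρ : Fin n → ℝ) (v w : Fin n → Fin n → ℝ) :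
    divG ω ρ (v - w) = divG ω ρ v - divG ω ρ w := by
  rw [eq_sub_iff_add_eq, ← divG_add, sub_add_cancel]

theorem gradG_add (ω : Fin n → Fin n → ℝ) (Φ Ψ : Fin n → ℝ) :
    gradG ω (Φ + Ψ) = gradG ω Φ + gradG ω Ψ := by
  ext i j
  simp only [gradG, Pi.add_apply]
  ring

theorem gradG_smul (ω : Fin n → Fin n → ℝ) (c : ℝ) (Φ : Fin n → ℝ) :
    gradG ω (c • Φ) = c • gradG ω Φ := by
  ext i j
  simp only [gradG, Pi.smul_apply, smul_eq_mul]
  ring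

theorem gradG_sub (ω : Fin n → Fin n → ℝ) (Φ Ψ : Fin n → ℝ) :
    gradG ω (Φ - Ψ) = gradG ω Φ - gradG ω Ψ := by
  rw [eq_sub_iff_add_eq, ← gradG_add, sub_add_cancel]

theorem isVF_gradG {ω : Fin n → Fin n → ℝ} (hω : ∀ i j, ω i j = ω j i) (Φ : Fin n → ℝ) :
    IsVF ω (gradG ω Φ) := by
  refine ⟨fun i j => ?_, fun i j h => by simp [gradG, h]⟩
  simp only [gradG, hω j i]
  ring

theorem IsVF.sub {ω v w : Fin n → Fin n → ℝ} (hv : IsVF ω v) (hw : IsVF ω w) :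
    IsVF ω (v - w) := by
  refine ⟨fun i j => ?_, fun i j h => ?_⟩
  · simp only [Pi.sub_apply, hv.1 i j, hw.1 i j]
    ring
  · simp [hv.2 i j h, hw.2 i j h]

/-- Summation by parts: `-div_G(ρ ·)` is the adjoint of `∇_G`. -/
theorem innerG_gradG_left {ω w : Fin n → Fin n → ℝ} (hω : ∀ i j, ω i j = ω j i)
    (hw : IsVF ω w) (ρ Φ : Fin n → ℝ) :
    innerG ω ρ (gradG ω Φ) w = -∑ i, Φ i * divG ω ρ w i := by
  have key : ∑ i, ∑ j, Φ j * (Real.sqrt (ω i j) * w i j * theta ρ i j) =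
      -∑ i, ∑ j, Φ i * (Real.sqrt (ω i j) * w i j * theta ρ i j) := by
    rw [Finset.sum_comm, ← Finset.sum_neg_distrib]
    refine Finset.sum_congr rfl fun i _ => ?_
    rw [← Finset.sum_neg_distrib]
    refine Finset.sum_congr rfl fun j _ => ?_
    rw [hω j i, hw.1 j i, theta, theta]
    ring
  have expand : ∑ i, ∑ j, (if ω i j ≠ 0 then gradG ω Φ i j * w i j * theta ρ i j else 0) =
      ∑ i, ∑ j, Φ i * (Real.sqrt (ω i j) * w i j * theta ρ i j) -
        ∑ i, ∑ j, Φ j * (Real.sqrt (ω i j) * w i j * theta ρ i j) := by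
    simp only [← Finset.sum_sub_distrib]
    refine Finset.sum_congr rfl fun i _ => Finset.sum_congr rfl fun j _ => ?_
    split_ifs with h
    · simp only [gradG]
      ring
    · rw [not_not] at h
      simp [h]
  rw [innerG, expand, key]
  simp only [divG, mul_neg, Finset.sum_neg_distrib, Finset.mul_sum]
  simp only [← Finset.mul_sum]
  ring

theorem sum_divG {ω w : Fin n → Fin n → ℝ} (hω : ∀ i j, ω i j = ω j i)
    (hw : IsVF ω w) (ρ : Fin n → ℝ) : ∑ i, divG ω ρ w i = 0 := by
  have h := innerG_gradG_left hω hw ρ fun _ => 1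
  simpa [innerG, gradG] using h

theorem eq_of_innerG_gradG_self_eq_zero {ω : Fin n → Fin n → ℝ} (hG : IsGraph ω)
    {ρ : Fin n → ℝ} (hρ : ∀ i, 0 < ρ i) {Φ : Fin n → ℝ}
    (h : innerG ω ρ (gradG ω Φ) (gradG ω Φ) = 0) (i j : Fin n) : Φ i = Φ j := by
  obtain ⟨-, -, hnn, hconn⟩ := hG
  have hθ : ∀ a b, 0 < theta ρ a b := fun a b => half_pos (add_pos (hρ a) (hρ b))
  have hterm : ∀ a b, 0 ≤
      if ω a b ≠ 0 then gradG ω Φ a b * gradG ω Φ a b * theta ρ a b else 0 := by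
    intro a b
    split_ifs
    · exact mul_nonneg (mul_self_nonneg _) (hθ a b).le
    · exact le_rfl
  have hsum := (mul_eq_zero.mp h).resolve_left (by norm_num)
  rw [Finset.sum_eq_zero_iff_of_nonneg fun a _ => Finset.sum_nonneg fun b _ => hterm a b] at hsum
  have hedge : ∀ a b, ω a b ≠ 0 → Φ a = Φ b := by
    intro a b hab
    have h0 := (Finset.sum_eq_zero_iff_of_nonneg fun b _ => hterm a b).mp
      (hsum a (Finset.mem_univ a)) b (Finset.mem_univ b)
    rw [if_pos hab] at h0
    have h1 := mul_self_eq_zero.mp ((mul_eq_zero.mp h0).resolve_right (hθ a b).ne')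
    have hsqrt : Real.sqrt (ω a b) ≠ 0 :=
      (Real.sqrt_pos.mpr (lt_of_le_of_ne (hnn a b) hab.symm)).ne'
    exact sub_eq_zero.mp ((mul_eq_zero.mp h1).resolve_left hsqrt)
  induction hconn i j with
  | refl => rfl
  | tail _ hbc ih => exact ih.trans (hedge _ _ hbc)

theorem eq_of_divG_gradG_eq_zero {ω : Fin n → Fin n → ℝ} (hG : IsGraph ω)
    {ρ : Fin n → ℝ} (hρ : ∀ i, 0 < ρ i) {Φ : Fin n → ℝ}
    (h : divG ω ρ (gradG ω Φ) = 0) (i j : Fin n) : Φ i = Φ j := by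
  refine eq_of_innerG_gradG_self_eq_zero hG hρ ?_ i j
  rw [innerG_gradG_left hG.1 (isVF_gradG hG.1 Φ), h]
  simp

/-- The weighted Laplacian `Φ ↦ div_G(ρ∇_GΦ)`, made invertible by adding `∑ i, Φ i` to every
component. -/
def shiftedLaplacian (ω : Fin n → Fin n → ℝ) (ρ : Fin n → ℝ) :
    (Fin n → ℝ) →ₗ[ℝ] (Fin n → ℝ) where
  toFun Φ := divG ω ρ (gradG ω Φ) + fun _ => ∑ i, Φ i
  map_add' Φ Ψ := by
    ext i
    simp only [gradG_add, divG_add, Pi.add_apply, Finset.sum_add_distrib]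
    ring
  map_smul' c Φ := by
    ext i
    simp only [gradG_smul, divG_smul, Pi.add_apply, Pi.smul_apply, smul_eq_mul,
      RingHom.id_apply, ← Finset.mul_sum]
    ring

theorem sum_shiftedLaplacian {ω : Fin n → Fin n → ℝ} (hω : ∀ i j, ω i j = ω j i)
    (ρ Φ : Fin n → ℝ) : ∑ i, shiftedLaplacian ω ρ Φ i = n * ∑ i, Φ i := by
  simp [shiftedLaplacian, Finset.sum_add_distrib, sum_divG hω (isVF_gradG hω Φ)]

theorem divG_gradG_eq_of_shiftedLaplacian_eq {ω : Fin n → Fin n → ℝ}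
    (hω : ∀ i j, ω i j = ω j i) (hn : n ≠ 0) {ρ Φ f : Fin n → ℝ} (hf : ∑ i, f i = 0)
    (h : shiftedLaplacian ω ρ Φ = f) : ∑ i, Φ i = 0 ∧ divG ω ρ (gradG ω Φ) = f := by
  have hs : ∑ i, Φ i = 0 := by
    have := sum_shiftedLaplacian hω ρ Φ
    rw [h, hf] at this
    exact (mul_eq_zero.mp this.symm).resolve_left (Nat.cast_ne_zero.mpr hn)
  refine ⟨hs, ?_⟩
  rw [← h]
  ext i
  simp [shiftedLaplacian, hs]

theorem shiftedLaplacian_injective {ω : Fin n → Fin n → ℝ} (hG : IsGraph ω)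
    {ρ : Fin n → ℝ} (hρ : ∀ i, 0 < ρ i) : Function.Injective (shiftedLaplacian ω ρ) := by
  rw [injective_iff_map_eq_zero]
  intro Φ hΦ
  ext i
  have hn : n ≠ 0 := i.pos.ne'
  obtain ⟨hs, hd⟩ := divG_gradG_eq_of_shiftedLaplacian_eq hG.1 hn (by simp) hΦ
  rw [Finset.sum_congr rfl fun j _ => eq_of_divG_gradG_eq_zero hG hρ hd j i] at hs
  simpa [hn] using hs

theorem exists_divG_gradG_eq {ω : Fin n → Fin n → ℝ} (hG : IsGraph ω) (hn : n ≠ 0)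
    {ρ : Fin n → ℝ} (hρ : ∀ i, 0 < ρ i) {f : Fin n → ℝ} (hf : ∑ i, f i = 0) :
    ∃ Φ : Fin n → ℝ, divG ω ρ (gradG ω Φ) = f := by
  obtain ⟨Φ, hΦ⟩ :=
    LinearMap.injective_iff_surjective.mp (shiftedLaplacian_injective hG hρ) f
  exact ⟨Φ, (divG_gradG_eq_of_shiftedLaplacian_eq hG.1 hn hf hΦ).2⟩

theorem innerG_add_self (ω : Fin n → Fin n → ℝ) (ρ : Fin n → ℝ) (v w : Fin n → Fin n → ℝ) :
    innerG ω ρ (v + w) (v + w) = innerG ω ρ v v + 2 * innerG ω ρ v w + innerG ω ρ w w := by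
  simp only [innerG, Finset.mul_sum, ← Finset.sum_add_distrib]
  refine Finset.sum_congr rfl fun i _ => Finset.sum_congr rfl fun j _ => ?_
  split_ifs
  · simp only [Pi.add_apply]
    ring
  · ring

/-- Hodge decomposition on graphs. -/
theorem hodge_decomposition
    (n : ℕ) (hn : 2 ≤ n) (ω : Fin n → Fin n → ℝ) (hG : IsGraph ω)
    (ρ : Fin n → ℝ) (hρ : PoG ρ) (v : Fin n → Fin n → ℝ) (hv : IsVF ω v) :
    ∃ (Φ : Fin n → ℝ) (u : Fin n → Fin n → ℝ),
      IsVF ω u ∧ (∀ i j, v i j = gradG ω Φ i j + u i j) ∧ divG ω ρ u = 0 ∧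
      (∀ (Φ' : Fin n → ℝ) (u' : Fin n → Fin n → ℝ), IsVF ω u' →
        (∀ i j, v i j = gradG ω Φ' i j + u' i j) → divG ω ρ u' = 0 →
          u' = u ∧ ∃ c : ℝ, ∀ i, Φ' i = Φ i + c) ∧
      innerG ω ρ v v = innerG ω ρ (gradG ω Φ) (gradG ω Φ) + innerG ω ρ u u := by
  have hn0 : n ≠ 0 := by omega
  obtain ⟨Φ, hΦ⟩ := exists_divG_gradG_eq hG hn0 hρ.2 (sum_divG hG.1 hv ρ)
  have hu : IsVF ω (v - gradG ω Φ) := hv.sub (isVF_gradG hG.1 Φ)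
  have hdiv : divG ω ρ (v - gradG ω Φ) = 0 := by rw [divG_sub, hΦ, sub_self]
  refine ⟨Φ, v - gradG ω Φ, hu, fun i j => by simp, hdiv, ?_, ?_⟩
  · intro Φ' u' _ hv' hdiv'
    have hv_eq : v = gradG ω Φ' + u' := by
      ext i j
      exact hv' i j
    have hd : divG ω ρ (gradG ω (Φ' - Φ)) = 0 := by
      rw [gradG_sub, divG_sub, hΦ, hv_eq, divG_add, hdiv', add_zero, sub_self]
    have hconst := eq_of_divG_gradG_eq_zero hG hρ.2 hd
    have hgrad : gradG ω Φ' = gradG ω Φ := by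
      rw [← sub_eq_zero, ← gradG_sub]
      ext i j
      simp only [gradG, hconst i j, sub_self, mul_zero, Pi.zero_apply]
    refine ⟨by rw [hv_eq, hgrad, add_sub_cancel_left], ?_⟩
    have i₀ : Fin n := ⟨0, Nat.pos_of_ne_zero hn0⟩
    refine ⟨(Φ' - Φ) i₀, fun i => ?_⟩
    rw [← hconst i i₀, Pi.sub_apply]
    ring
  · have horth : innerG ω ρ (gradG ω Φ) (v - gradG ω Φ) = 0 := by
      rw [innerG_gradG_left hG.1 hu, hdiv]
      simp
    have h := innerG_add_self ω ρ (gradG ω Φ) (v - gradG ω Φ)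
    rwa [add_sub_cancel, horth, mul_zero, add_zero] at h

end FPEGraph
end
end

section
/- Let ρ : (a,b) → P_o(G) be a differentiable solution of the Fokker–Planck equation ρ'(t) = −L(ρ(t))F(ρ(t)). Then t ↦ 𝓕(ρ(t)) is twice differentiable and for all t ∈ (a,b), (d²/dt²) 𝓕(ρ(t)) = 2·ρ'(t)^T Hess𝓕(ρ(t)) ρ'(t) − F(ρ(t))^T L(ρ'(t)) F(ρ(t)), where L(ρ'(t)) denotes the symmetric matrix with (L(σ)Φ)_i = Σ_{j∈N(i)} ω_{ij} θ_{ij}(σ)(Φ_i − Φ_j) evaluated at σ = ρ'(t). -/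
open Finset Filter Matrix
open scoped Classical

noncomputable section

namespace FPEGraph

variable {n : ℕ}

theorem hasDerivAt_dotProduct {u v : ℝ → Fin n → ℝ} {u' v' : Fin n → ℝ} {t : ℝ}
    (hu : HasDerivAt u u' t) (hv : HasDerivAt v v' t) :
    HasDerivAt (fun s => u s ⬝ᵥ v s) (u' ⬝ᵥ v t + u t ⬝ᵥ v') t := by
  simp only [dotProduct, ← Finset.sum_add_distrib]
  exact HasDerivAt.fun_sum fun i _ => (hasDerivAt_pi.1 hu i).fun_mul (hasDerivAt_pi.1 hv i)

theorem hasDerivAt_mulVec {A : ℝ → Matrix (Fin n) (Fin n) ℝ} {A' : Matrix (Fin n) (Fin n) ℝ}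
    {u : ℝ → Fin n → ℝ} {u' : Fin n → ℝ} {t : ℝ}
    (hA : ∀ i j, HasDerivAt (fun s => A s i j) (A' i j) t) (hu : HasDerivAt u u' t) :
    HasDerivAt (fun s => (A s).mulVec (u s)) (A'.mulVec (u t) + (A t).mulVec u') t :=
  hasDerivAt_pi.2 fun i => hasDerivAt_dotProduct (hasDerivAt_pi.2 (hA i)) hu

theorem hasDerivAt_const_mulVec (A : Matrix (Fin n) (Fin n) ℝ)
    {u : ℝ → Fin n → ℝ} {u' : Fin n → ℝ} {t : ℝ} (hu : HasDerivAt u u' t) :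
    HasDerivAt (fun s => A.mulVec (u s)) (A.mulVec u') t := by
  simpa using hasDerivAt_mulVec (A := fun _ => A) (A' := 0)
    (fun i j => hasDerivAt_const t (A i j)) hu

theorem Lmat_isSymm {ω : Fin n → Fin n → ℝ} (hω : ∀ i j, ω i j = ω j i) (σ : Fin n → ℝ) :
    (Lmat ω σ).IsSymm := by
  ext i j
  by_cases hij : i = j
  · subst hij; rfl
  · simp [Lmat, theta, hij, Ne.symm hij, hω j i, add_comm]

theorem hasDerivAt_Lmat (ω : Fin n → Fin n → ℝ) {ρ : ℝ → Fin n → ℝ} {ρ' : Fin n → ℝ} {t : ℝ}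
    (h : HasDerivAt ρ ρ' t) (i j : Fin n) :
    HasDerivAt (fun s => Lmat ω (ρ s) i j) (Lmat ω ρ' i j) t := by
  have hθ : ∀ k, HasDerivAt (fun s => ω i k * theta (ρ s) i k) (ω i k * theta ρ' i k) t :=
    fun k => (((hasDerivAt_pi.1 h i).fun_add (hasDerivAt_pi.1 h k)).div_const 2).const_mul _
  unfold Lmat
  split_ifs
  · exact HasDerivAt.fun_sum fun k _ => hθ k
  · exact (hθ j).fun_neg

theorem hasDerivAt_gradF (W : Matrix (Fin n) (Fin n) ℝ) (V : Fin n → ℝ) (β : ℝ)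
    {ρ : ℝ → Fin n → ℝ} {ρ' : Fin n → ℝ} {t : ℝ} (h : HasDerivAt ρ ρ' t)
    (h0 : ∀ i, ρ t i ≠ 0) :
    HasDerivAt (fun s => gradF W V β (ρ s)) ((hessF W β (ρ t)).mulVec ρ') t := by
  refine hasDerivAt_pi.2 fun i => ?_
  have hW := hasDerivAt_pi.1 (hasDerivAt_const_mulVec W h) i
  have hlog := ((hasDerivAt_pi.1 h i).log (h0 i)).const_mul β
  refine (((hW.const_add (V i)).fun_add hlog).add_const β).congr_deriv ?_
  simp only [hessF, Matrix.add_mulVec, Matrix.smul_mulVec, Matrix.mulVec_diagonal,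
    Pi.add_apply, Pi.smul_apply, smul_eq_mul]
  ring

theorem hasDerivAt_freeEnergy {W : Matrix (Fin n) (Fin n) ℝ} (hW : W.IsSymm)
    (V : Fin n → ℝ) (β : ℝ) {ρ : ℝ → Fin n → ℝ} {ρ' : Fin n → ℝ} {t : ℝ}
    (h : HasDerivAt ρ ρ' t) (h0 : ∀ i, ρ t i ≠ 0) :
    HasDerivAt (fun s => freeEnergy W V β (ρ s)) (gradF W V β (ρ t) ⬝ᵥ ρ') t := by
  have hquad := (hasDerivAt_dotProduct h (hasDerivAt_const_mulVec W h)).const_mul (1 / 2)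
  have hlin := hasDerivAt_dotProduct (hasDerivAt_const t V) h
  have hent : HasDerivAt (fun s => β * ∑ i, ρ s i * Real.log (ρ s i))
      (β * ∑ i, (Real.log (ρ t i) + 1) * ρ' i) t :=
    (HasDerivAt.fun_sum fun i _ =>
      (Real.hasDerivAt_mul_log (h0 i)).comp t (hasDerivAt_pi.1 h i)).const_mul β
  refine ((hquad.fun_add hlin).fun_add hent).congr_deriv ?_
  have hsymm : ρ t ⬝ᵥ W.mulVec ρ' = ρ' ⬝ᵥ W.mulVec (ρ t) := by
    rw [Matrix.dotProduct_mulVec, ← Matrix.mulVec_transpose, hW.eq, dotProduct_comm]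
  rw [hsymm]
  simp only [zero_dotProduct, zero_add]
  rw [← two_mul, ← mul_assoc]
  norm_num
  simp only [dotProduct, gradF, Finset.mul_sum, ← Finset.sum_add_distrib]
  exact Finset.sum_congr rfl fun i _ => by ring

/-- along a solution of the Fokker–Planck equation, `t ↦ 𝓕(ρ(t))` is twice
differentiable with second derivative `2 ρ̇ᵀ Hess𝓕(ρ) ρ̇ - F(ρ)ᵀ L(ρ̇) F(ρ)`. -/
theorem freeEnergy_second_derivative
    (n : ℕ) (hn : 2 ≤ n) (ω : Fin n → Fin n → ℝ) (hG : IsGraph ω)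
    (W : Matrix (Fin n) (Fin n) ℝ) (hW : W.IsSymm) (V : Fin n → ℝ) (β : ℝ) (hβ : 0 < β)
    (a b : ℝ) (ρ : ℝ → Fin n → ℝ)
    (hρ : ∀ t ∈ Set.Ioo a b, PoG (ρ t))
    (hode : ∀ t ∈ Set.Ioo a b,
      HasDerivAt ρ (-(Lmat ω (ρ t)).mulVec (gradF W V β (ρ t))) t) :
    ∃ g : ℝ → ℝ, ∀ t ∈ Set.Ioo a b,
      HasDerivAt (fun s => freeEnergy W V β (ρ s)) (g t) t ∧
      HasDerivAt g
        (2 * ((-(Lmat ω (ρ t)).mulVec (gradF W V β (ρ t))) ⬝ᵥ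
              (hessF W β (ρ t)).mulVec (-(Lmat ω (ρ t)).mulVec (gradF W V β (ρ t)))) -
          gradF W V β (ρ t) ⬝ᵥ
            (Lmat ω (-(Lmat ω (ρ t)).mulVec (gradF W V β (ρ t)))).mulVec
              (gradF W V β (ρ t))) t := by
  refine ⟨fun s => gradF W V β (ρ s) ⬝ᵥ (-(Lmat ω (ρ s)).mulVec (gradF W V β (ρ s))),
    fun t ht => ?_⟩
  have h0 : ∀ i, ρ t i ≠ 0 := fun i => ((hρ t ht).2 i).ne'
  have h := hode t ht
  refine ⟨hasDerivAt_freeEnergy hW V β h h0, ?_⟩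
  have hF := hasDerivAt_gradF W V β h h0
  refine (hasDerivAt_dotProduct hF
    (hasDerivAt_mulVec (hasDerivAt_Lmat ω h) hF).fun_neg).congr_deriv ?_
  set F := gradF W V β (ρ t)
  set r := -(Lmat ω (ρ t)).mulVec F with hr
  set F' := (hessF W β (ρ t)).mulVec r
  have hsymm : F ⬝ᵥ (Lmat ω (ρ t)).mulVec F' = -(r ⬝ᵥ F') := by
    rw [Matrix.dotProduct_mulVec, ← Matrix.mulVec_transpose, (Lmat_isSymm hG.1 _).eq, hr,
      neg_dotProduct, neg_neg]
  rw [dotProduct_neg, dotProduct_neg, dotProduct_add, hsymm, ← dotProduct_neg, ← hr,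
    dotProduct_comm F' r]
  ring

end FPEGraph
end
end
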